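/- Let n ≥ 6 be even and M = S_n(Alt_n), with z = a_1⋯a_n. Then for all indices i, j and any three distinct indices k, l, r, the equalities a_i^2 a_j (a_k a_l a_r z) = a_j a_i^2 (a_k a_l a_r z) and a_i a_j a_i a_j (a_k a_l a_r z) = a_j a_i a_j a_i (a_k a_l a_r z) hold in M. -/

import Mathlib

/-- The defining relation of `Sₙ(H)`: the word `a₁a₂⋯aₙ` equals the word
`a_{σ(1)}a_{σ(2)}⋯a_{σ(n)}` for every `σ ∈ H`. -/
def SnRel (n : ℕ) (H : Set (Equiv.Perm (Fin n))) :
    FreeMonoid (Fin n) → FreeMonoid (Fin n) → Prop := fun x y =>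
  ∃ σ ∈ H, x = FreeMonoid.ofList (List.ofFn (fun i : Fin n => i)) ∧
    y = FreeMonoid.ofList (List.ofFn (fun i : Fin n => σ i))

/-- The congruence generated by the defining relations. -/
def SnCon (n : ℕ) (H : Set (Equiv.Perm (Fin n))) : Con (FreeMonoid (Fin n)) :=
  conGen (SnRel n H)

/-- The monoid `Sₙ(H) = ⟨a₁,…,aₙ ∣ a₁a₂⋯aₙ = a_{σ(1)}⋯a_{σ(n)}, σ ∈ H⟩`. -/
abbrev Sn (n : ℕ) (H : Set (Equiv.Perm (Fin n))) : Type := (SnCon n H).Quotient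

/-- The generator `aᵢ` of `Sₙ(H)`. -/
def gen (n : ℕ) (H : Set (Equiv.Perm (Fin n))) (i : Fin n) : Sn n H :=
  (SnCon n H).mk' (FreeMonoid.of i)

/-- The element `z = a₁a₂⋯aₙ` of `Sₙ(H)`. -/
def zel (n : ℕ) (H : Set (Equiv.Perm (Fin n))) : Sn n H :=
  (SnCon n H).mk' (FreeMonoid.ofList (List.ofFn (fun i : Fin n => i)))

/-- The set of even permutations of `{1,…,n}`. -/
def AltH (n : ℕ) : Set (Equiv.Perm (Fin n)) := ↑(alternatingGroup (Fin n))

/-- The monoid `Sₙ(Altₙ)`. -/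
abbrev SAlt (n : ℕ) : Type := Sn n (AltH n)

/-- The generator `aᵢ` of `Sₙ(Altₙ)`. -/
def a (n : ℕ) (i : Fin n) : SAlt n := gen n (AltH n) i

/-- The element `z = a₁⋯aₙ` of `Sₙ(Altₙ)`. -/
def z (n : ℕ) : SAlt n := zel n (AltH n)

/-- The image in `Sₙ(Altₙ)` of a word in the generators. -/
def word (n : ℕ) (L : List (Fin n)) : SAlt n :=
  (SnCon n (AltH n)).mk' (FreeMonoid.ofList L)

theorem word_append {n : ℕ} (L L' : List (Fin n)) : word n (L ++ L') = word n L * word n L' := by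
  simp [word, FreeMonoid.ofList_append]

theorem word_cons {n : ℕ} (i : Fin n) (L : List (Fin n)) : word n (i :: L) = a n i * word n L :=
  word_append [i] L

theorem word_nil (n : ℕ) : word n [] = 1 := rfl

/-- The word of every even permutation represents `z`. -/
theorem word_ofFn_eq_z {n : ℕ} {σ : Equiv.Perm (Fin n)} (hσ : σ.sign = 1) :
    word n (List.ofFn σ) = z n := by
  refine ((Con.eq _).2 (ConGen.Rel.of _ _ ⟨σ, ?_, rfl, rfl⟩)).symm
  simpa [AltH, Equiv.Perm.mem_alternatingGroup] using hσ

theorem ofFn_mul_finRotate {n : ℕ} (σ : Equiv.Perm (Fin n)) :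
    List.ofFn (σ * finRotate n) = (List.ofFn σ).rotate 1 := by
  cases n with
  | zero => simp
  | succ n =>
    refine List.ext_getElem (by simp) fun m h₁ h₂ => ?_
    simp only [List.getElem_ofFn, List.getElem_rotate, List.length_ofFn, Equiv.Perm.mul_apply,
      finRotate_apply]
    congr 1
    ext
    simp [Fin.val_add]

theorem ofFn_mul_finRotate_pow {n : ℕ} (σ : Equiv.Perm (Fin n)) (m : ℕ) :
    List.ofFn (σ * finRotate n ^ m) = (List.ofFn σ).rotate m := by
  induction m with
  | zero => simp
  | succ m ih => rw [pow_succ, ← mul_assoc, ofFn_mul_finRotate, ih, List.rotate_rotate]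

theorem sign_finRotate_of_even {n : ℕ} (hn : 6 ≤ n) (heven : Even n) :
    (finRotate n).sign = -1 := by
  rw [sign_finRotate, Odd.neg_one_pow]
  exact Nat.Even.sub_odd (by omega) heven odd_one

/-- Three distinct letters are the first three letters of the word of an even permutation. -/
theorem exists_ofFn_eq_cons {n : ℕ} (hn : 6 ≤ n) {k l r : Fin n} (hkl : k ≠ l) (hlr : l ≠ r)
    (hkr : k ≠ r) :
    ∃ (σ : Equiv.Perm (Fin n)) (L : List (Fin n)),
      σ.sign = 1 ∧ List.ofFn σ = k :: l :: r :: L := by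
  obtain ⟨m, rfl⟩ : ∃ m, n = m + 3 := ⟨n - 3, by omega⟩
  have hmt := alternatingGroup.isMultiplyPretransitive (Fin (m + 3))
  have hmt₃ : MulAction.IsMultiplyPretransitive (alternatingGroup (Fin (m + 3))) (Fin (m + 3)) 3 :=
    MulAction.isMultiplyPretransitive_of_le (n := Nat.card (Fin (m + 3)) - 2)
      (by simp; omega) (Nat.sub_le _ _)
  have hinj : Function.Injective ![k, l, r] := by
    intro x y
    fin_cases x <;> fin_cases y <;> simp [hkl, hlr, hkr, hkl.symm, hlr.symm, hkr.symm]
  obtain ⟨g, hg⟩ := MulAction.isMultiplyPretransitive_iff.1 hmt₃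
    (Fin.castLEEmb (by omega)) ⟨![k, l, r], hinj⟩
  have key (t : Fin 3) : (g : Equiv.Perm (Fin (m + 3))) (Fin.castLE (by omega) t) = ![k, l, r] t :=
    DFunLike.congr_fun hg t
  refine ⟨g, List.ofFn fun t : Fin m => (g : Equiv.Perm (Fin (m + 3))) t.succ.succ.succ,
    Equiv.Perm.mem_alternatingGroup.1 g.2, ?_⟩
  rw [List.ofFn_succ, List.ofFn_succ, List.ofFn_succ]
  exact congrArg₂ _ (key 0) (congrArg₂ _ (key 1) (congrArg₂ _ (key 2) rfl))

/-- `z` commutes with products of two distinct generators. -/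
theorem pair_mul_z {n : ℕ} (hn : 6 ≤ n) (heven : Even n) {k l : Fin n} (hkl : k ≠ l) :
    a n k * (a n l * z n) = z n * (a n k * a n l) := by
  obtain ⟨r, hr⟩ : ∃ r, r ∉ ({k, l} : Finset (Fin n)) := by
    by_contra! h
    have h_card := Finset.card_le_card (fun x _ => h x : Finset.univ ⊆ ({k, l} : Finset (Fin n)))
    have := Finset.card_le_two (a := k) (b := l)
    rw [Finset.card_univ, Fintype.card_fin] at h_card
    omega
  simp only [Finset.mem_insert, Finset.mem_singleton, not_or] at hr
  obtain ⟨σ, L, hσ, hL⟩ := exists_ofFn_eq_cons hn hkl (Ne.symm hr.2) (Ne.symm hr.1)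
  have h_left := word_ofFn_eq_z hσ
  have h_right := word_ofFn_eq_z (σ := σ * finRotate n ^ 2)
    (by simp [hσ, sign_finRotate_of_even hn heven])
  rw [ofFn_mul_finRotate_pow] at h_right
  rw [hL] at h_left h_right
  simp only [List.rotate_cons_succ, List.rotate_zero, List.cons_append, word_append, word_cons,
    word_nil, mul_one] at h_left h_right
  nth_rw 1 [← h_right]
  rw [← h_left]
  simp only [mul_assoc]

/-- Moving `z` across three distinct generators permutes them by an odd permutation. -/
theorem triple_mul_z {n : ℕ} (hn : 6 ≤ n) (heven : Even n) {k l r : Fin n} (hkl : k ≠ l)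
    (hlr : l ≠ r) (hkr : k ≠ r) {τ : Equiv.Perm (Fin n)} (hτ : τ.sign = -1)
    (hfix : ∀ t, t ≠ k → t ≠ l → t ≠ r → τ t = t) :
    a n k * (a n l * (a n r * z n)) = z n * (a n (τ k) * (a n (τ l) * a n (τ r))) := by
  obtain ⟨σ, L, hσ, hL⟩ := exists_ofFn_eq_cons hn hkl hlr hkr
  have h_nodup : (k :: l :: r :: L).Nodup := hL ▸ List.nodup_ofFn.2 σ.injective
  have h_map : L.map τ = L := by
    refine (List.map_congr_left fun t ht => ?_).trans (List.map_id L)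
    apply hfix t <;> rintro rfl <;> simp_all
  have h_left := word_ofFn_eq_z hσ
  have h_right := word_ofFn_eq_z (σ := τ * σ * finRotate n ^ 3)
    (by simp [hσ, hτ, sign_finRotate_of_even hn heven, pow_succ])
  rw [ofFn_mul_finRotate_pow, Equiv.Perm.coe_mul, ← List.map_ofFn] at h_right
  rw [hL] at h_left h_right
  simp only [List.map_cons, h_map, List.rotate_cons_succ, List.rotate_zero, List.cons_append,
    word_append, word_cons, word_nil, mul_one] at h_left h_right
  nth_rw 1 [← h_right]
  rw [← h_left]
  simp only [mul_assoc]

theorem pair_mul_z_mul {n : ℕ} (hn : 6 ≤ n) (heven : Even n) {k l : Fin n} (hkl : k ≠ l)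
    (x : SAlt n) : a n k * (a n l * (z n * x)) = z n * (a n k * (a n l * x)) := by
  simpa only [mul_assoc] using congrArg (· * x) (pair_mul_z hn heven hkl)

theorem triple_mul_z_mul {n : ℕ} (hn : 6 ≤ n) (heven : Even n) {k l r : Fin n} (hkl : k ≠ l)
    (hlr : l ≠ r) (hkr : k ≠ r) (x : SAlt n) :
    a n k * (a n l * (a n r * (z n * x))) = z n * (a n l * (a n k * (a n r * x))) := by
  have h := triple_mul_z hn heven hkl hlr hkr (Equiv.Perm.sign_swap hkl)
    fun t hk hl _ => Equiv.swap_apply_of_ne_of_ne hk hl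
  rw [Equiv.swap_apply_left, Equiv.swap_apply_right,
    Equiv.swap_apply_of_ne_of_ne hkr.symm hlr.symm] at h
  simpa only [mul_assoc] using congrArg (· * x) h

theorem triple_mul_z_mul' {n : ℕ} (hn : 6 ≤ n) (heven : Even n) {k l r : Fin n} (hkl : k ≠ l)
    (hlr : l ≠ r) (hkr : k ≠ r) (x : SAlt n) :
    a n k * (a n l * (a n r * (z n * x))) = z n * (a n k * (a n r * (a n l * x))) := by
  have h := triple_mul_z hn heven hkl hlr hkr (Equiv.Perm.sign_swap hlr)
    fun t _ hl hr => Equiv.swap_apply_of_ne_of_ne hl hr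
  rw [Equiv.swap_apply_left, Equiv.swap_apply_right,
    Equiv.swap_apply_of_ne_of_ne hkl hkr] at h
  simpa only [mul_assoc] using congrArg (· * x) h

/-- Three distinct generators in front of `z` may be permuted cyclically. -/
theorem triple_mul_z_rotate {n : ℕ} (hn : 6 ≤ n) (heven : Even n) {k l r : Fin n} (hkl : k ≠ l)
    (hlr : l ≠ r) (hkr : k ≠ r) :
    a n k * a n l * a n r * z n = a n l * a n r * a n k * z n := by
  have h := (triple_mul_z_mul hn heven hkl hlr hkr 1).trans
    (triple_mul_z_mul' hn heven hlr hkr.symm hkl.symm 1).symm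
  simpa [mul_assoc] using h

/-- The square relation multiplied by `aₖaₗaᵣz`, when `j ≠ k`. -/
theorem sq_mul_triple_of_ne {n : ℕ} (hn : 6 ≤ n) (heven : Even n) {i j k l r : Fin n}
    (hij : i ≠ j) (hik : i ≠ k) (hil : i ≠ l) (hjk : j ≠ k) (hkl : k ≠ l)
    (hlr : l ≠ r) (x : SAlt n) :
    a n i * (a n i * (a n j * (a n k * (a n l * (a n r * (z n * x)))))) =
      a n j * (a n i * (a n i * (a n k * (a n l * (a n r * (z n * x)))))) := by
  rw [pair_mul_z_mul hn heven hlr,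
    triple_mul_z_mul hn heven hij hjk hik,
    ← triple_mul_z_mul' hn heven hjk hik.symm hij.symm,
    pair_mul_z_mul hn heven hik.symm,
    pair_mul_z_mul hn heven hij,
    ← triple_mul_z_mul hn heven hij.symm hik hjk,
    ← pair_mul_z_mul hn heven hil,
    triple_mul_z_mul hn heven hik.symm hil hkl,
    ← pair_mul_z_mul hn heven hik,
    ← pair_mul_z_mul hn heven hlr]

/-- The square relation multiplied by `aₖaₗaᵣz`, when `j = k`. -/
theorem sq_mul_triple_of_eq {n : ℕ} (hn : 6 ≤ n) (heven : Even n) {i k l r : Fin n}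
    (hik : i ≠ k) (hil : i ≠ l) (hkl : k ≠ l) (hkr : k ≠ r) (hlr : l ≠ r) (x : SAlt n) :
    a n i * (a n i * (a n k * (a n k * (a n l * (a n r * (z n * x)))))) =
      a n k * (a n i * (a n i * (a n k * (a n l * (a n r * (z n * x)))))) := by
  rw [triple_mul_z_mul hn heven hkl hlr hkr,
    pair_mul_z_mul hn heven hik,
    ← triple_mul_z_mul hn heven hik.symm hil hkl,
    triple_mul_z_mul' hn heven hik.symm hil hkl,
    ← pair_mul_z_mul hn heven hkl,
    triple_mul_z_mul hn heven hik hkl hil,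
    ← pair_mul_z_mul hn heven hik.symm,
    ← triple_mul_z_mul hn heven hil hkl.symm hik,
    pair_mul_z_mul hn heven hkl.symm,
    ← triple_mul_z_mul hn heven hkl hlr hkr]

/-- The alternating relation multiplied by `aₖaₗaᵣz`, when `i` and `j` differ from `k`. -/
theorem alternating_mul_triple {n : ℕ} (hn : 6 ≤ n) (heven : Even n) {i j k l r : Fin n}
    (hij : i ≠ j) (hik : i ≠ k) (hjk : j ≠ k) (hlr : l ≠ r) (x : SAlt n) :
    a n i * (a n j * (a n i * (a n j * (a n k * (a n l * (a n r * (z n * x))))))) =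
      a n j * (a n i * (a n j * (a n i * (a n k * (a n l * (a n r * (z n * x))))))) := by
  rw [pair_mul_z_mul hn heven hlr,
    triple_mul_z_mul hn heven hij hjk hik,
    ← triple_mul_z_mul' hn heven hjk hik.symm hij.symm,
    triple_mul_z_mul hn heven hjk hik.symm hij.symm,
    pair_mul_z_mul hn heven hij,
    ← triple_mul_z_mul hn heven hij.symm hik hjk,
    ← pair_mul_z_mul hn heven hij.symm,
    triple_mul_z_mul hn heven hjk.symm hij.symm hik.symm,
    ← triple_mul_z_mul' hn heven hij.symm hik hjk,
    ← pair_mul_z_mul hn heven hlr]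

/-- in `M = Sₙ(Altₙ)` with `n ≥ 6` even, for all `i, j` and distinct
`k, l, r` one has `aᵢ²aⱼ(aₖaₗaᵣz) = aⱼaᵢ²(aₖaₗaᵣz)` and
`aᵢaⱼaᵢaⱼ(aₖaₗaᵣz) = aⱼaᵢaⱼaᵢ(aₖaₗaᵣz)`. -/
theorem stmt10 (n : ℕ) (hn : 6 ≤ n) (heven : Even n) (i j k l r : Fin n)
    (hkl : k ≠ l) (hlr : l ≠ r) (hkr : k ≠ r) :
    a n i ^ 2 * a n j * (a n k * a n l * a n r * z n) =
      a n j * a n i ^ 2 * (a n k * a n l * a n r * z n) ∧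
    a n i * a n j * a n i * a n j * (a n k * a n l * a n r * z n) =
      a n j * a n i * a n j * a n i * (a n k * a n l * a n r * z n) := by
  suffices h : ∀ k l r : Fin n, k ≠ l → l ≠ r → k ≠ r → i ≠ j →
      (i ≠ k → i ≠ l → a n i ^ 2 * a n j * (a n k * a n l * a n r * z n) =
        a n j * a n i ^ 2 * (a n k * a n l * a n r * z n)) ∧
      (i ≠ k → j ≠ k → a n i * a n j * a n i * a n j * (a n k * a n l * a n r * z n) =
        a n j * a n i * a n j * a n i * (a n k * a n l * a n r * z n)) by
    rcases eq_or_ne i j with rfl | hij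
    · exact ⟨by rw [pow_mul_comm'], rfl⟩
    have rot : a n k * a n l * a n r * z n = a n l * a n r * a n k * z n :=
      triple_mul_z_rotate hn heven hkl hlr hkr
    have rot' : a n k * a n l * a n r * z n = a n r * a n k * a n l * z n :=
      rot.trans (triple_mul_z_rotate hn heven hlr hkr.symm hkl.symm)
    have h₀ := h k l r hkl hlr hkr hij
    have h₁ := h l r k hlr hkr.symm hkl.symm hij
    have h₂ := h r k l hkr.symm hkl hlr.symm hij
    rw [← rot] at h₁
    rw [← rot'] at h₂
    constructor
    · by_cases hik : i = k
      · subst hik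
        exact h₁.1 hkl hkr
      · by_cases hil : i = l
        · subst hil
          exact h₂.1 hlr hik
        · exact h₀.1 hik hil
    · by_cases hk : i ≠ k ∧ j ≠ k
      · exact h₀.2 hk.1 hk.2
      · by_cases hl : i ≠ l ∧ j ≠ l
        · exact h₁.2 hl.1 hl.2
        · exact h₂.2 (by grind) (by grind)
  intro k l r hkl hlr hkr hij
  refine ⟨fun hik hil => ?_, fun hik hjk => ?_⟩
  · rcases eq_or_ne j k with rfl | hjk
    · simpa [pow_two, mul_assoc] using sq_mul_triple_of_eq hn heven hik hil hkl hkr hlr 1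
    · simpa [pow_two, mul_assoc] using
        sq_mul_triple_of_ne hn heven hij hik hil hjk hkl hlr 1
  · simpa [mul_assoc] using alternating_mul_triple hn heven hij hik hjk hlr 1
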